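/- Let m,n ≥ 2, let ε = (ε_1,…,ε_{min{m,n}}) ∈ {1,−1}^{min{m,n}} be a given sign pattern, and let 𝓛 : ℝ^{m×n} → ℝ^{m×n} be a linear transformation. Then the following are equivalent: (1) 𝓛 maps the set of SR(ε) matrices onto itself; (2) 𝓛 maps the set of SR₂((ε_1,ε_2)) matrices onto itself; (3) 𝓛 is a composition of one or more of the following transformations: (a) A ↦ F·A·E, where F ∈ ℝ^{m×m} and E ∈ ℝ^{n×n} are diagonal matrices with positive diagonal entries; (b) A ↦ P_m·A·P_n, where P_m, P_n are exchange matrices; and (c) A ↦ Aᵀ, the last being allowed only when m = n. -/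

import Mathlib

open Matrix

/-- The `n × n` exchange matrix: ones on the antidiagonal, zeros elsewhere. -/
def exchangeMat (n : ℕ) : Matrix (Fin n) (Fin n) ℝ :=
  Matrix.of fun i j => if j = i.rev then (1 : ℝ) else 0

/-- `A` is sign regular of order `k` with sign pattern `ε` (SRₖ(ε)): for each
`1 ≤ r ≤ k`, every nonzero `r × r` minor of `A` has sign `ε r`. -/
def IsSRkPat {m n : ℕ} (k : ℕ) (ε : ℕ → ℝ) (A : Matrix (Fin m) (Fin n) ℝ) : Prop :=
  ∀ r : ℕ, 1 ≤ r → r ≤ k →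
    ∀ (f : Fin r → Fin m) (g : Fin r → Fin n),
      StrictMono f → StrictMono g →
      (A.submatrix f g).det ≠ 0 → 0 < ε r * (A.submatrix f g).det

/-- The elementary transformations (a)–(c) of Theorem B: positive diagonal
equivalence, `A ↦ Pₘ A Pₙ` with exchange matrices, and (when `m = n`)
transposition. -/
def ElemSRPatMap (m n : ℕ)
    (T : Matrix (Fin m) (Fin n) ℝ → Matrix (Fin m) (Fin n) ℝ) : Prop :=
  (∃ F : Fin m → ℝ, ∃ Ed : Fin n → ℝ, (∀ i, 0 < F i) ∧ (∀ j, 0 < Ed j) ∧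
      T = fun A => Matrix.diagonal F * A * Matrix.diagonal Ed) ∨
  (T = fun A => exchangeMat m * A * exchangeMat n) ∨
  (∃ h : m = n,
      T = fun A => Matrix.of fun i j => A (Fin.cast h.symm j) (Fin.cast h i))

section MonomialMaps

/-- A linear map which maps a set of entrywise nonnegative vectors containing the
standard basis onto itself is injective and monomial. -/
theorem exists_monomial_of_image_eq {ι : Type*} [Fintype ι] [DecidableEq ι]
    (L : (ι → ℝ) →ₗ[ℝ] (ι → ℝ)) (T : Set (ι → ℝ)) (hT : L '' T = T)
    (hpos : ∀ A ∈ T, ∀ x, 0 ≤ A x) (hsingle : ∀ p, Pi.single p (1 : ℝ) ∈ T) :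
    Function.Injective L ∧ ∃ (σ : ι ≃ ι) (c : ι → ℝ), (∀ x, 0 < c x) ∧
      ∀ A x, L A (σ x) = c x * A x := by
  have hsurj : Function.Surjective L := by
    rw [← LinearMap.range_eq_top, eq_top_iff, ← (Pi.basisFun ℝ ι).span_eq, Submodule.span_le]
    rintro _ ⟨p, rfl⟩
    obtain ⟨A, -, hA⟩ : Pi.single p (1 : ℝ) ∈ L '' T := by rw [hT]; exact hsingle p
    exact ⟨A, by simpa using hA⟩
  have hinj : Function.Injective L := LinearMap.injective_iff_surjective.2 hsurj
  have hL : ∀ p x, 0 ≤ L (Pi.single p 1) x := fun p x =>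
    hpos _ (hT ▸ Set.mem_image_of_mem L (hsingle p)) x
  have hK : ∀ q, ∃ B : ι → ℝ, (∀ x, 0 ≤ B x) ∧ L B = Pi.single q 1 := fun q => by
    obtain ⟨B, hB, hB'⟩ : Pi.single q (1 : ℝ) ∈ L '' T := by rw [hT]; exact hsingle q
    exact ⟨B, hpos B hB, hB'⟩
  choose K hK0 hK using hK
  have hexp : ∀ A : ι → ℝ, A = ∑ q, A q • Pi.single q (1 : ℝ) := fun A => by
    ext x; simp [Finset.sum_apply, Pi.single_apply]
  have hKL : ∀ A : ι → ℝ, A = ∑ q, L A q • K q := fun A => by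
    apply hinj
    rw [map_sum]
    simp only [map_smul, hK]
    exact hexp (L A)
  have key : ∀ p, ∃ q, ∃ d : ℝ, 0 < d ∧ L (Pi.single p 1) = d • Pi.single q 1 := fun p => by
    have hne : L (Pi.single p 1) ≠ 0 := by
      rw [Ne, map_eq_zero_iff L hinj]
      simp
    obtain ⟨q, hq⟩ := Function.ne_iff.1 hne
    have hq0 : 0 < L (Pi.single p 1) q := lt_of_le_of_ne (hL p q) (Ne.symm hq)
    have hzero : ∀ x, x ≠ p → K q x = 0 := fun x hx => by
      have h := congrFun (hKL (Pi.single p 1)) x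
      rw [Finset.sum_apply, Pi.single_eq_of_ne hx] at h
      have h2 := (Finset.sum_eq_zero_iff_of_nonneg (fun y _ => by
        simpa using mul_nonneg (hL p y) (hK0 y x))).1 h.symm q (Finset.mem_univ q)
      have h3 : L (Pi.single p 1) q * K q x = 0 := by simpa using h2
      exact (mul_eq_zero.1 h3).resolve_left hq0.ne'
    have hKq : K q = K q p • Pi.single p (1 : ℝ) := by
      ext x
      by_cases hx : x = p
      · subst hx; simp
      · simp [hzero x hx, hx]
    have hKp : K q p ≠ 0 := fun h => by
      have h1 := hK q
      rw [hKq, h, zero_smul, map_zero] at h1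
      simpa using congrFun h1 q
    refine ⟨q, (K q p)⁻¹, inv_pos.2 (lt_of_le_of_ne (hK0 q p) hKp.symm), ?_⟩
    rw [eq_inv_smul_iff₀ hKp, ← map_smul, ← hKq, hK]
  choose σ c hc hσ using key
  have hσinj : Function.Injective σ := fun p p' h => by
    by_contra hne
    have h1 : L (c p' • Pi.single p 1) = L (c p • Pi.single p' 1) := by
      rw [map_smul, map_smul, hσ, hσ, h, smul_smul, smul_smul, mul_comm]
    have h2 := congrFun (hinj h1) p
    simp [Pi.single_eq_of_ne hne, (hc p').ne'] at h2
  refine ⟨hinj, Equiv.ofBijective σ (Finite.injective_iff_bijective.1 hσinj), c, hc,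
    fun A x => ?_⟩
  conv_lhs => rw [hexp A]
  rw [map_sum, Finset.sum_apply]
  simp only [map_smul, hσ, Equiv.ofBijective_apply, Pi.smul_apply, smul_eq_mul, Pi.single_apply,
    hσinj.eq_iff, mul_ite, mul_one, mul_zero]
  simp [mul_comm]

end MonomialMaps

section Grid

/-- An injective map of grids preserving and reflecting collinearity, and mapping one horizontal
pair to a horizontal pair, is a product map. -/
theorem exists_prodMap_of_collinear {α β γ δ : Type*} (σ : α × β → γ × δ)
    (hinj : Function.Injective σ)
    (hcol : ∀ p q : α × β, p.1 = q.1 ∨ p.2 = q.2 → (σ p).1 = (σ q).1 ∨ (σ p).2 = (σ q).2)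
    (hncol : ∀ p q : α × β, p.1 ≠ q.1 → p.2 ≠ q.2 → (σ p).1 ≠ (σ q).1 ∧ (σ p).2 ≠ (σ q).2)
    (i₀ : α) (j₀ j₁ : β) (hj : j₀ ≠ j₁) (h : (σ (i₀, j₀)).1 = (σ (i₀, j₁)).1) :
    ∃ (π : α → γ) (ρ : β → δ), ∀ i j, σ (i, j) = (π i, ρ j) := by
  have hrow : ∀ j, (σ (i₀, j)).1 = (σ (i₀, j₀)).1 := fun j => by
    rcases hcol (i₀, j) (i₀, j₀) (Or.inl rfl) with h0 | h0
    · exact h0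
    rcases hcol (i₀, j) (i₀, j₁) (Or.inl rfl) with h1 | h1
    · exact h1.trans h.symm
    · have := hinj (Prod.ext h (h0.symm.trans h1))
      exact absurd (congrArg Prod.snd this) hj
  have hcolumn : ∀ i j, (σ (i, j)).2 = (σ (i₀, j)).2 := fun i j => by
    by_cases hi : i = i₀
    · rw [hi]
    rcases hcol (i, j) (i₀, j) (Or.inr rfl) with h0 | h0
    · obtain ⟨j', hj'⟩ : ∃ j', j ≠ j' := by
        by_cases hjj : j = j₀
        · exact ⟨j₁, hjj ▸ hj⟩
        · exact ⟨j₀, hjj⟩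
      exact absurd (h0.trans ((hrow j).trans (hrow j').symm))
        (hncol (i, j) (i₀, j') hi hj').1
    · exact h0
  refine ⟨fun i => (σ (i, j₀)).1, fun j => (σ (i₀, j)).2, fun i j => Prod.ext ?_ (hcolumn i j)⟩
  rcases hcol (i, j) (i, j₀) (Or.inl rfl) with h0 | h0
  · exact h0
  · have := hinj (Prod.ext (hrow j) (((hcolumn i j).symm.trans h0).trans (hcolumn i j₀)))
    obtain rfl : j = j₀ := congrArg Prod.snd this
    rfl

theorem strictMono_fin_eq_id {n : ℕ} {f : Fin n → Fin n} (hf : StrictMono f) : f = id :=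
  hf.range_inj strictMono_id |>.1
    (by simp [(Finite.injective_iff_surjective.1 hf.injective).range_eq])

theorem strictAnti_fin_eq_rev {n : ℕ} {f : Fin n → Fin n} (hf : StrictAnti f) : f = Fin.rev := by
  have h : StrictMono (Fin.rev ∘ f) := fun i j hij => Fin.rev_lt_rev.2 (hf hij)
  funext i
  rw [← Fin.rev_inj, Fin.rev_rev]
  exact congrFun (strictMono_fin_eq_id h) i

/-- Self-maps of `Fin m` and `Fin n` whose monotonicities agree on all pairs are both the
identity or both the reversal. -/
theorem eq_id_or_eq_rev_of_sign {m n : ℕ} (hm : 2 ≤ m) (hn : 2 ≤ n) (π : Fin m → Fin m)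
    (ρ : Fin n → Fin n)
    (h : ∀ (i i' : Fin m) (j j' : Fin n), i ≠ i' → j ≠ j' →
      0 < (((i : ℕ) : ℝ) - (i' : ℕ)) * ((j : ℕ) - (j' : ℕ)) *
      ((((π i : ℕ) : ℝ) - (π i' : ℕ)) * ((ρ j : ℕ) - (ρ j' : ℕ)))) :
    (π = id ∧ ρ = id) ∨ (π = Fin.rev ∧ ρ = Fin.rev) := by
  have h' : ∀ (i i' : Fin m) (j j' : Fin n), i < i' → j < j' →
      0 < (((π i : ℕ) : ℝ) - (π i' : ℕ)) * ((ρ j : ℕ) - (ρ j' : ℕ)) := fun i i' j j' hi hj => by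
    have h1 : ((i : ℕ) : ℝ) - (i' : ℕ) < 0 := sub_neg.2 (Nat.cast_lt.2 hi)
    have h2 : ((j : ℕ) : ℝ) - (j' : ℕ) < 0 := sub_neg.2 (Nat.cast_lt.2 hj)
    exact pos_of_mul_pos_right (h i i' j j' hi.ne hj.ne) (mul_pos_of_neg_of_neg h1 h2).le
  have lt_iff : ∀ {k : ℕ} {a b : Fin k}, a < b ↔ ((a : ℕ) : ℝ) - (b : ℕ) < 0 := by
    intro k a b; rw [sub_neg, Nat.cast_lt, Fin.lt_def]
  have h01m : (⟨0, by omega⟩ : Fin m) < ⟨1, by omega⟩ := by simp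
  have h01n : (⟨0, by omega⟩ : Fin n) < ⟨1, by omega⟩ := by simp
  have hcase := h' _ _ _ _ h01m h01n
  rcases pos_and_pos_or_neg_and_neg_of_mul_pos hcase with ⟨ha, hb⟩ | ⟨ha, hb⟩
  · refine Or.inr ⟨strictAnti_fin_eq_rev fun i i' hi => ?_,
      strictAnti_fin_eq_rev fun j j' hj => ?_⟩
    · have := pos_of_mul_pos_left (h' _ _ _ _ hi h01n) hb.le
      rw [lt_iff]; linarith
    · have := pos_of_mul_pos_right (h' _ _ _ _ h01m hj) ha.le
      rw [lt_iff]; linarith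
  · refine Or.inl ⟨strictMono_fin_eq_id fun i i' hi => ?_,
      strictMono_fin_eq_id fun j j' hj => ?_⟩
    · exact lt_iff.2 (neg_of_mul_pos_left (h' _ _ _ _ hi h01n) hb.le)
    · exact lt_iff.2 (neg_of_mul_pos_right (h' _ _ _ _ h01m hj) ha.le)

end Grid

section TwoByTwo

variable {m n : ℕ}

/-- Positive when `p` and `q` are in diagonal position, negative when they are in antidiagonal
position, zero when they share a row or a column. -/
def gridDisc (p q : Fin m × Fin n) : ℝ :=
  (((p.1 : ℕ) : ℝ) - (q.1 : ℕ)) * (((p.2 : ℕ) : ℝ) - (q.2 : ℕ))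

theorem gridDisc_comm (p q : Fin m × Fin n) : gridDisc p q = gridDisc q p := by
  unfold gridDisc; ring

theorem gridDisc_corner (p q : Fin m × Fin n) :
    gridDisc (p.1, q.2) (q.1, p.2) = -gridDisc p q := by
  simp only [gridDisc]; ring

theorem gridDisc_ne_zero_iff {p q : Fin m × Fin n} :
    gridDisc p q ≠ 0 ↔ p.1 ≠ q.1 ∧ p.2 ≠ q.2 := by
  simp only [gridDisc, mul_ne_zero_iff, sub_ne_zero, Ne, Nat.cast_inj, Fin.val_inj]

/-- Entrywise nonnegative matrices all of whose `2 × 2` minors have the sign of `t` or vanish. -/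
def IsSignedTwo (t : ℝ) (A : Fin m × Fin n → ℝ) : Prop :=
  (∀ p, 0 ≤ A p) ∧
    ∀ p q, t * gridDisc p q < 0 → A p * A q ≤ A (p.1, q.2) * A (q.1, p.2)

/-- Matrices supported on at most two rows. -/
def IsTwoRow (A : Fin m × Fin n → ℝ) : Prop :=
  ∃ i i', ∀ x : Fin m × Fin n, x.1 ≠ i → x.1 ≠ i' → A x = 0

/-- The monomial map `A ↦ B`, `B (σ x) = c x * A x`, preserves the set `T`, which lies between
the two-row matrices satisfying `IsSignedTwo t` and all the matrices satisfying it. -/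
structure IsMonomialPreserver (t : ℝ) (T : Set (Fin m × Fin n → ℝ))
    (σ : Fin m × Fin n ≃ Fin m × Fin n) (c : Fin m × Fin n → ℝ) : Prop where
  sub : ∀ A ∈ T, IsSignedTwo t A
  mem : ∀ A, IsSignedTwo t A → IsTwoRow A → A ∈ T
  pos : ∀ x, 0 < c x
  mem_iff : ∀ A B : Fin m × Fin n → ℝ, (∀ x, B (σ x) = c x * A x) → (A ∈ T ↔ B ∈ T)

namespace IsMonomialPreserver

variable {t : ℝ} {T : Set (Fin m × Fin n → ℝ)} {σ : Fin m × Fin n ≃ Fin m × Fin n}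
  {c : Fin m × Fin n → ℝ}

theorem symm (h : IsMonomialPreserver t T σ c) :
    IsMonomialPreserver t T σ.symm (fun x => (c (σ.symm x))⁻¹) where
  sub := h.sub
  mem := h.mem
  pos x := inv_pos.2 (h.pos _)
  mem_iff A B hAB := (h.mem_iff B A fun x => by
    have := hAB (σ x)
    rw [σ.symm_apply_apply] at this
    rw [this, mul_inv_cancel_left₀ (h.pos x).ne']).symm

theorem disc_neg (h : IsMonomialPreserver t T σ c) {p q : Fin m × Fin n}
    (hpq : t * gridDisc p q < 0) : t * gridDisc (σ p) (σ q) < 0 := by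
  by_contra hnot
  have hne : p.1 ≠ q.1 ∧ p.2 ≠ q.2 :=
    gridDisc_ne_zero_iff.1 fun h0 => by simp [h0] at hpq
  let B : Fin m × Fin n → ℝ := fun x => if x = σ p ∨ x = σ q then 1 else 0
  have hB : B ∈ T := by
    refine h.mem B ⟨fun x => by simp only [B]; split_ifs <;> simp, fun x y hxy => ?_⟩
      ⟨(σ p).1, (σ q).1, fun x h1 h2 => if_neg ?_⟩
    · have h0 : B x * B y = 0 := by
        by_contra hxy0
        have hx : x = σ p ∨ x = σ q := by
          by_contra hx; exact hxy0 (by simp only [B, if_neg hx, zero_mul])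
        have hy : y = σ p ∨ y = σ q := by
          by_contra hy; exact hxy0 (by simp only [B, if_neg hy, mul_zero])
        rcases hx with rfl | rfl <;> rcases hy with rfl | rfl
        · simp [gridDisc] at hxy
        · exact hnot hxy
        · exact hnot (gridDisc_comm (σ q) (σ p) ▸ hxy)
        · simp [gridDisc] at hxy
      rw [h0]
      apply mul_nonneg <;> simp only [B] <;> split_ifs <;> simp
    · rintro (rfl | rfl)
      · exact h1 rfl
      · exact h2 rfl
  let A : Fin m × Fin n → ℝ := fun x => (c x)⁻¹ * B (σ x)
  have hA : A ∈ T := (h.mem_iff A B fun x => by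
    simp only [A]; rw [mul_inv_cancel_left₀ (h.pos x).ne']).2 hB
  have hle := (h.sub A hA).2 p q hpq
  have hr : A (p.1, q.2) = 0 := by
    simp only [A, B, σ.injective.eq_iff]
    rw [if_neg, mul_zero]
    rintro (h0 | h0)
    · exact hne.2 (Prod.ext_iff.1 h0).2.symm
    · exact hne.1 (Prod.ext_iff.1 h0).1
  have hp : 0 < A p := by simpa [A, B] using h.pos p
  have hq : 0 < A q := by simpa [A, B] using h.pos q
  rw [hr, zero_mul] at hle
  exact absurd (mul_pos hp hq) (not_lt.2 hle)

theorem corner (h : IsMonomialPreserver t T σ c) {p q : Fin m × Fin n}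
    (hpq : t * gridDisc p q < 0) :
    (σ (p.1, q.2) = ((σ p).1, (σ q).2) ∧ σ (q.1, p.2) = ((σ q).1, (σ p).2) ∨
      σ (q.1, p.2) = ((σ p).1, (σ q).2) ∧ σ (p.1, q.2) = ((σ q).1, (σ p).2)) ∧
    c p * c q ≤ c (p.1, q.2) * c (q.1, p.2) := by
  let u : Fin m → ℝ := fun i => if i = p.1 ∨ i = q.1 then 1 else 0
  let v : Fin n → ℝ := fun j => if j = p.2 ∨ j = q.2 then 1 else 0
  let A : Fin m × Fin n → ℝ := fun x => u x.1 * v x.2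
  have hu : ∀ i, 0 ≤ u i := fun i => by simp only [u]; split_ifs <;> simp
  have hv : ∀ j, 0 ≤ v j := fun j => by simp only [v]; split_ifs <;> simp
  have hA : A ∈ T := by
    refine h.mem A ⟨fun x => mul_nonneg (hu _) (hv _), fun x y _ => le_of_eq ?_⟩
      ⟨p.1, q.1, fun x h1 h2 => ?_⟩
    · simp only [A]; ring
    · simp [A, u, h1, h2]
  let B : Fin m × Fin n → ℝ := fun x => c (σ.symm x) * A (σ.symm x)
  have hBσ : ∀ x, B (σ x) = c x * A x := fun x => by simp [B]
  have hB : B ∈ T := (h.mem_iff A B hBσ).1 hA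
  have hbad := h.disc_neg hpq
  have hne : (σ p).1 ≠ (σ q).1 ∧ (σ p).2 ≠ (σ q).2 :=
    gridDisc_ne_zero_iff.1 fun h0 => by simp [h0] at hbad
  have hle := (h.sub B hB).2 _ _ hbad
  have hAp : A p = 1 := by simp [A, u, v]
  have hAq : A q = 1 := by simp [A, u, v]
  have hAr : A (p.1, q.2) = 1 := by simp [A, u, v]
  have hAs : A (q.1, p.2) = 1 := by simp [A, u, v]
  rw [hBσ, hBσ, hAp, hAq, mul_one, mul_one] at hle
  have hprod : B ((σ p).1, (σ q).2) * B ((σ q).1, (σ p).2) ≠ 0 :=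
    ((mul_pos (h.pos p) (h.pos q)).trans_le hle).ne'
  have hsupp : ∀ y, B y ≠ 0 → y ≠ σ p → y ≠ σ q → y = σ (p.1, q.2) ∨ y = σ (q.1, p.2) := by
    intro y hy hyp hyq
    obtain ⟨x, rfl⟩ := σ.surjective y
    rw [hBσ] at hy
    have hx : A x ≠ 0 := right_ne_zero_of_mul hy
    have hx1 : x.1 = p.1 ∨ x.1 = q.1 := by
      by_contra h0; exact hx (by simp only [A, u, if_neg h0, zero_mul])
    have hx2 : x.2 = p.2 ∨ x.2 = q.2 := by
      by_contra h0; exact hx (by simp only [A, v, if_neg h0, mul_zero])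
    rcases hx1 with h1 | h1 <;> rcases hx2 with h2 | h2
    · exact absurd (congrArg σ (Prod.ext h1 h2)) hyp
    · exact Or.inl (congrArg σ (Prod.ext h1 h2))
    · exact Or.inr (congrArg σ (Prod.ext h1 h2))
    · exact absurd (congrArg σ (Prod.ext h1 h2)) hyq
  have hy := hsupp _ (left_ne_zero_of_mul hprod)
    (fun h0 => hne.2 (Prod.ext_iff.1 h0).2.symm) (fun h0 => hne.1 (Prod.ext_iff.1 h0).1)
  have hz := hsupp _ (right_ne_zero_of_mul hprod)
    (fun h0 => hne.1 (Prod.ext_iff.1 h0).1.symm) (fun h0 => hne.2 (Prod.ext_iff.1 h0).2)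
  have hyz : ((σ p).1, (σ q).2) ≠ ((σ q).1, (σ p).2) := fun h0 => hne.1 (Prod.ext_iff.1 h0).1
  rcases hy with hy | hy <;> rcases hz with hz | hz
  · exact absurd (hy.trans hz.symm) hyz
  · refine ⟨Or.inl ⟨hy.symm, hz.symm⟩, ?_⟩
    rwa [hy, hz, hBσ, hBσ, hAr, hAs, mul_one, mul_one] at hle
  · refine ⟨Or.inr ⟨hy.symm, hz.symm⟩, ?_⟩
    rwa [hy, hz, hBσ, hBσ, hAr, hAs, mul_one, mul_one, mul_comm (c (q.1, p.2))] at hle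
  · exact absurd (hy.trans hz.symm) hyz

theorem disc_pos (h : IsMonomialPreserver t T σ c) {p q : Fin m × Fin n}
    (hpq : 0 < t * gridDisc p q) : 0 < t * gridDisc (σ p) (σ q) := by
  have hbad : t * gridDisc (p.1, q.2) (q.1, p.2) < 0 := by
    rw [gridDisc_corner]; linarith
  have himg := h.disc_neg hbad
  rw [← neg_neg (gridDisc (σ (p.1, q.2)) _), ← gridDisc_corner] at himg
  rcases (h.corner hbad).1 with ⟨hp, hq⟩ | ⟨hp, hq⟩
  · rw [← hp, ← hq] at himg
    simp only [Prod.mk.eta] at himg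
    linarith
  · rw [← hp, ← hq, gridDisc_comm] at himg
    simp only [Prod.mk.eta] at himg
    linarith

theorem disc_mul_pos (h : IsMonomialPreserver t T σ c) (ht : t ≠ 0) {p q : Fin m × Fin n}
    (h1 : p.1 ≠ q.1) (h2 : p.2 ≠ q.2) : 0 < gridDisc p q * gridDisc (σ p) (σ q) := by
  have hne : t * gridDisc p q ≠ 0 := mul_ne_zero ht (gridDisc_ne_zero_iff.2 ⟨h1, h2⟩)
  have hmul : 0 < (t * gridDisc p q) * (t * gridDisc (σ p) (σ q)) := by
    rcases hne.lt_or_gt with h0 | h0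
    · exact mul_pos_of_neg_of_neg h0 (h.disc_neg h0)
    · exact mul_pos h0 (h.disc_pos h0)
  have : 0 < t ^ 2 * (gridDisc p q * gridDisc (σ p) (σ q)) := by
    convert hmul using 1; ring
  exact pos_of_mul_pos_right this (sq_nonneg t)

theorem noncollinear (h : IsMonomialPreserver t T σ c) (ht : t ≠ 0) (p q : Fin m × Fin n)
    (h1 : p.1 ≠ q.1) (h2 : p.2 ≠ q.2) : (σ p).1 ≠ (σ q).1 ∧ (σ p).2 ≠ (σ q).2 :=
  gridDisc_ne_zero_iff.1 (right_ne_zero_of_mul (h.disc_mul_pos ht h1 h2).ne')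

theorem collinear (h : IsMonomialPreserver t T σ c) (ht : t ≠ 0) (p q : Fin m × Fin n)
    (hpq : p.1 = q.1 ∨ p.2 = q.2) : (σ p).1 = (σ q).1 ∨ (σ p).2 = (σ q).2 := by
  by_contra! hne
  have := h.symm.noncollinear ht _ _ hne.1 hne.2
  simp only [Equiv.symm_apply_apply] at this
  exact hpq.elim this.1 this.2

theorem coeff_eq_of_neg (h : IsMonomialPreserver t T σ c) {p q : Fin m × Fin n}
    (hpq : t * gridDisc p q < 0) : c p * c q = c (p.1, q.2) * c (q.1, p.2) := by
  obtain ⟨hcor, hle⟩ := h.corner hpq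
  refine hle.antisymm ?_
  have h' := (h.symm.corner (h.disc_neg hpq)).2
  have hpos := h.pos
  have hinv : (c p * c q)⁻¹ ≤ (c (p.1, q.2) * c (q.1, p.2))⁻¹ := by
    rw [mul_inv, mul_inv]
    rcases hcor with ⟨h1, h2⟩ | ⟨h1, h2⟩
    · simpa only [← h1, ← h2, Equiv.symm_apply_apply] using h'
    · rw [mul_comm (c (p.1, q.2))⁻¹]
      simpa only [← h1, ← h2, Equiv.symm_apply_apply] using h'
  exact (inv_le_inv₀ (mul_pos (hpos _) (hpos _)) (mul_pos (hpos _) (hpos _))).1 hinv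

theorem coeff_eq (h : IsMonomialPreserver t T σ c) (ht : t ≠ 0) (p q : Fin m × Fin n) :
    c p * c q = c (p.1, q.2) * c (q.1, p.2) := by
  by_cases h1 : p.1 = q.1
  · rw [← h1, mul_comm, show (p.1, q.2) = q from Prod.ext h1 rfl]
  by_cases h2 : p.2 = q.2
  · rw [h2, show (p.1, q.2) = p from Prod.ext rfl h2.symm]
  rcases (mul_ne_zero ht (gridDisc_ne_zero_iff.2 ⟨h1, h2⟩)).lt_or_gt with h0 | h0
  · exact h.coeff_eq_of_neg h0
  · have hbad : t * gridDisc (p.1, q.2) (q.1, p.2) < 0 := by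
      rw [gridDisc_corner]; linarith
    simpa using (h.coeff_eq_of_neg hbad).symm

/-- The scaling factors of a monomial preserver form a rank-one matrix. -/
theorem exists_coeff_eq_mul (h : IsMonomialPreserver t T σ c) (ht : t ≠ 0) (i₀ : Fin m)
    (j₀ : Fin n) : ∃ (F : Fin m → ℝ) (E : Fin n → ℝ), (∀ i, 0 < F i) ∧ (∀ j, 0 < E j) ∧
      ∀ x, c x = F x.1 * E x.2 := by
  refine ⟨fun i => c (i, j₀), fun j => c (i₀, j) / c (i₀, j₀), fun i => h.pos _,
    fun j => div_pos (h.pos _) (h.pos _), fun x => ?_⟩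
  rw [mul_div_assoc', eq_div_iff (h.pos _).ne']
  exact h.coeff_eq ht x (i₀, j₀)

/-- The permutation of positions underlying a monomial preserver is the identity, the rotation by
a half turn, or one of these followed by a transposition. -/
theorem perm_cases (h : IsMonomialPreserver t T σ c) (ht : t ≠ 0) (hm : 2 ≤ m) (hn : 2 ≤ n) :
    (∀ x, σ x = x) ∨ (∀ x, σ x = (x.1.rev, x.2.rev)) ∨
    ∃ hmn : m = n, (∀ x, σ x = (Fin.cast hmn.symm x.2, Fin.cast hmn x.1)) ∨
      ∀ x, σ x = (Fin.cast hmn.symm x.2.rev, Fin.cast hmn x.1.rev) := by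
  have hj : (⟨0, by omega⟩ : Fin n) ≠ ⟨1, by omega⟩ := by simp
  rcases h.collinear ht (⟨0, by omega⟩, ⟨0, by omega⟩) (⟨0, by omega⟩, ⟨1, by omega⟩)
    (Or.inl rfl) with h0 | h0
  · obtain ⟨π, ρ, hπρ⟩ := exists_prodMap_of_collinear σ σ.injective (h.collinear ht)
      (h.noncollinear ht) _ _ _ hj h0
    have := eq_id_or_eq_rev_of_sign hm hn π ρ fun i i' j j' hi hj => by
      simpa [hπρ, gridDisc] using h.disc_mul_pos ht (p := (i, j)) (q := (i', j')) hi hj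
    rcases this with ⟨rfl, rfl⟩ | ⟨rfl, rfl⟩
    · exact Or.inl fun x => hπρ x.1 x.2
    · exact Or.inr (Or.inl fun x => hπρ x.1 x.2)
  · obtain ⟨ρ, π, hπρ⟩ := exists_prodMap_of_collinear (fun x => (σ x).swap)
      (Prod.swap_injective.comp σ.injective) (fun p q hpq => (h.collinear ht p q hpq).symm)
      (fun p q h1 h2 => (h.noncollinear ht p q h1 h2).symm) _ _ _ hj h0
    have hσ : ∀ i j, σ (i, j) = (π j, ρ i) := fun i j => by
      simpa using congrArg Prod.swap (hπρ i j)
    have hρ : Function.Injective ρ := fun i i' hii => by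
      have h1 : σ (i, ⟨0, by omega⟩) = σ (i', ⟨0, by omega⟩) := by rw [hσ, hσ, hii]
      exact congrArg Prod.fst (σ.injective h1)
    have hπ : Function.Injective π := fun j j' hjj => by
      have h1 : σ (⟨0, by omega⟩, j) = σ (⟨0, by omega⟩, j') := by rw [hσ, hσ, hjj]
      exact congrArg Prod.snd (σ.injective h1)
    have hmn : m = n := le_antisymm (by simpa using Fintype.card_le_of_injective ρ hρ)
      (by simpa using Fintype.card_le_of_injective π hπ)
    subst hmn
    have := eq_id_or_eq_rev_of_sign hm hn ρ π fun i i' j j' hi hj => by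
      have := h.disc_mul_pos ht (p := (i, j)) (q := (i', j')) hi hj
      simp only [hσ, gridDisc] at this
      rwa [mul_comm (((π j : ℕ) : ℝ) - _)] at this
    refine Or.inr (Or.inr ⟨rfl, ?_⟩)
    rcases this with ⟨rfl, rfl⟩ | ⟨rfl, rfl⟩
    · exact Or.inl fun x => hσ x.1 x.2
    · exact Or.inr fun x => hσ x.1 x.2

end IsMonomialPreserver

end TwoByTwo

section ElementaryMaps

variable {m n : ℕ}

theorem exchangeMat_mul_mul_exchangeMat (A : Matrix (Fin m) (Fin n) ℝ) :
    exchangeMat m * A * exchangeMat n = A.submatrix Fin.rev Fin.rev := by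
  ext i j
  have h : ∀ x : Fin n, j = x.rev ↔ x = j.rev := fun x => by
    rw [eq_comm, Fin.rev_eq_iff]
  simp [Matrix.mul_apply, exchangeMat, h]

theorem IsSRkPat.diagonal_mul_mul_diagonal {k : ℕ} {ε : ℕ → ℝ} {A : Matrix (Fin m) (Fin n) ℝ}
    (hA : IsSRkPat k ε A) {F : Fin m → ℝ} {E : Fin n → ℝ} (hF : ∀ i, 0 < F i)
    (hE : ∀ j, 0 < E j) :
    IsSRkPat k ε (Matrix.diagonal F * A * Matrix.diagonal E) := by
  intro r h1 h2 f g hf hg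
  have hdet : ((Matrix.diagonal F * A * Matrix.diagonal E).submatrix f g).det =
      (∏ i, F (f i)) * (∏ j, E (g j)) * (A.submatrix f g).det := by
    have hsub : (Matrix.diagonal F * A * Matrix.diagonal E).submatrix f g =
        Matrix.diagonal (F ∘ f) * A.submatrix f g * Matrix.diagonal (E ∘ g) := by
      ext i j
      simp [Matrix.mul_diagonal, Matrix.diagonal_mul]
    rw [hsub, Matrix.det_mul, Matrix.det_mul, Matrix.det_diagonal, Matrix.det_diagonal]
    simp only [Function.comp_apply]
    ring
  have hpos : 0 < (∏ i, F (f i)) * ∏ j, E (g j) :=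
    mul_pos (Finset.prod_pos fun i _ => hF _) (Finset.prod_pos fun j _ => hE _)
  rw [hdet]
  intro hne
  rw [mul_left_comm]
  exact mul_pos hpos (hA r h1 h2 f g hf hg (right_ne_zero_of_mul hne))

theorem IsSRkPat.submatrix_rev {k : ℕ} {ε : ℕ → ℝ} {A : Matrix (Fin m) (Fin n) ℝ}
    (hA : IsSRkPat k ε A) : IsSRkPat k ε (A.submatrix Fin.rev Fin.rev) := by
  intro r h1 h2 f g hf hg
  have hmono : ∀ {l : ℕ} {f : Fin r → Fin l}, StrictMono f →
      StrictMono (Fin.rev ∘ f ∘ Fin.rev) := fun hf _ _ hij =>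
    Fin.rev_lt_rev.2 (hf (Fin.rev_lt_rev.2 hij))
  have hdet : ((A.submatrix Fin.rev Fin.rev).submatrix f g).det =
      (A.submatrix (Fin.rev ∘ f ∘ Fin.rev) (Fin.rev ∘ g ∘ Fin.rev)).det := by
    rw [← Matrix.det_submatrix_equiv_self Fin.revPerm]
    rfl
  rw [hdet]
  exact hA r h1 h2 _ _ (hmono hf) (hmono hg)

theorem IsSRkPat.transpose {k : ℕ} {ε : ℕ → ℝ} {A : Matrix (Fin m) (Fin n) ℝ}
    (hA : IsSRkPat k ε A) : IsSRkPat k ε Aᵀ := by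
  intro r h1 h2 f g hf hg
  rw [← Matrix.transpose_submatrix, Matrix.det_transpose]
  exact hA r h1 h2 g f hg hf

theorem ElemSRPatMap.image_eq {T : Matrix (Fin m) (Fin n) ℝ → Matrix (Fin m) (Fin n) ℝ}
    (hT : ElemSRPatMap m n T) (k : ℕ) (ε : ℕ → ℝ) :
    T '' {A | IsSRkPat k ε A} = {A | IsSRkPat k ε A} := by
  rcases hT with ⟨F, E, hF, hE, rfl⟩ | rfl | ⟨rfl, rfl⟩
  · refine Set.Subset.antisymm ?_ fun A hA => ?_
    · rintro _ ⟨A, hA, rfl⟩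
      exact IsSRkPat.diagonal_mul_mul_diagonal hA hF hE
    · refine ⟨Matrix.diagonal (fun i => (F i)⁻¹) * A * Matrix.diagonal (fun j => (E j)⁻¹),
        IsSRkPat.diagonal_mul_mul_diagonal hA (fun i => inv_pos.2 (hF i))
          (fun j => inv_pos.2 (hE j)), ?_⟩
      ext i j
      have h1 := (hF i).ne'
      have h2 := (hE j).ne'
      simp only [Matrix.mul_diagonal, Matrix.diagonal_mul]
      field_simp
  · simp only [exchangeMat_mul_mul_exchangeMat]
    refine Set.Subset.antisymm ?_ fun A hA => ?_
    · rintro _ ⟨A, hA, rfl⟩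
      exact IsSRkPat.submatrix_rev hA
    · refine ⟨_, IsSRkPat.submatrix_rev hA, ?_⟩
      ext i j
      simp
  · refine Set.Subset.antisymm ?_ fun A hA => ?_
    · rintro _ ⟨A, hA, rfl⟩
      exact IsSRkPat.transpose hA
    · exact ⟨_, IsSRkPat.transpose hA, rfl⟩

theorem image_foldr_comp_eq {α : Type*} {S : Set α} {L : List (α → α)}
    (hL : ∀ T ∈ L, T '' S = S) : L.foldr (· ∘ ·) id '' S = S := by
  induction L with
  | nil => exact Set.image_id S
  | cons T L ih =>
    rw [List.foldr_cons, Set.image_comp, ih fun T' hT' => hL T' (List.mem_cons_of_mem _ hT'),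
      hL T List.mem_cons_self]

end ElementaryMaps

section Classification

variable {m n : ℕ}

theorem isSRkPat_two_iff {ε : ℕ → ℝ} (h1 : ε 1 = 1 ∨ ε 1 = -1) (h2 : ε 2 = 1 ∨ ε 2 = -1)
    (A : Matrix (Fin m) (Fin n) ℝ) :
    IsSRkPat 2 ε A ↔ IsSignedTwo (ε 2) fun p => ε 1 * A p.1 p.2 := by
  have hsq : ∀ a b : ℝ, ε 1 * a * (ε 1 * b) = a * b := fun a b => by
    rcases h1 with h | h <;> rw [h] <;> ring
  simp only [IsSignedTwo, hsq]
  constructor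
  · intro hA
    refine ⟨fun p => ?_, fun p q hpq => ?_⟩
    · by_cases h0 : A p.1 p.2 = 0
      · simp [h0]
      · have := hA 1 le_rfl one_le_two (fun _ => p.1) (fun _ => p.2)
          (Subsingleton.strictMono _) (Subsingleton.strictMono _)
        simp only [Matrix.det_fin_one, Matrix.submatrix_apply] at this
        exact (this h0).le
    · have hminor : ∀ {i i' : Fin m} {j j' : Fin n}, i < i' → j < j' →
          0 ≤ ε 2 * (A i j * A i' j' - A i j' * A i' j) := fun {i i' j j'} hi hj => by
        have := hA 2 one_le_two le_rfl ![i, i'] ![j, j']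
          (by simpa [Fin.strictMono_iff_lt_succ] using hi)
          (by simpa [Fin.strictMono_iff_lt_succ] using hj)
        simp only [Matrix.det_fin_two, Matrix.submatrix_apply, Matrix.cons_val_zero,
          Matrix.cons_val_one] at this
        by_cases h0 : A i j * A i' j' - A i j' * A i' j = 0
        · rw [h0, mul_zero]
        · exact (this h0).le
      have hcast : ∀ {l : ℕ} {a b : Fin l}, a < b → ((a : ℕ) : ℝ) - (b : ℕ) < 0 :=
        fun hab => sub_neg.2 (Nat.cast_lt.2 hab)
      have hne : p.1 ≠ q.1 ∧ p.2 ≠ q.2 :=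
        gridDisc_ne_zero_iff.1 fun h0 => by simp [h0] at hpq
      unfold gridDisc at hpq
      rcases hne.1.lt_or_gt with hi | hi <;> rcases hne.2.lt_or_gt with hj | hj <;>
        have ha := hcast hi <;> have hb := hcast hj <;> have hab := mul_pos_of_neg_of_neg ha hb <;>
        have hm := hminor hi hj <;> rcases h2 with h | h <;> rw [h] at hpq hm <;> nlinarith
  · rintro ⟨hpos, hbad⟩ r hr1 hr2 f g hf hg hne
    obtain rfl | rfl : r = 1 ∨ r = 2 := by omega
    · rw [Matrix.det_fin_one, Matrix.submatrix_apply] at hne ⊢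
      refine lt_of_le_of_ne (hpos (f 0, g 0)) (mul_ne_zero ?_ hne).symm
      rcases h1 with h | h <;> rw [h] <;> norm_num
    · simp only [Matrix.det_fin_two, Matrix.submatrix_apply] at hne ⊢
      have hf' : ((f 0 : ℕ) : ℝ) - (f 1 : ℕ) < 0 :=
        sub_neg.2 (Nat.cast_lt.2 (hf Fin.zero_lt_one))
      have hg' : ((g 0 : ℕ) : ℝ) - (g 1 : ℕ) < 0 :=
        sub_neg.2 (Nat.cast_lt.2 (hg Fin.zero_lt_one))
      have hfg := mul_pos_of_neg_of_neg hf' hg'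
      refine lt_of_le_of_ne ?_ (mul_ne_zero ?_ hne).symm
      · rcases h2 with h | h <;> simp only [h] at hbad ⊢
        · have := hbad (f 0, g 1) (f 1, g 0) (by simp only [gridDisc]; nlinarith)
          simp only at this
          linarith
        · have := hbad (f 0, g 0) (f 1, g 1) (by simp only [gridDisc]; nlinarith)
          simp only at this
          linarith
      · rcases h2 with h | h <;> rw [h] <;> norm_num

theorem isSignedTwo_single (t : ℝ) (p : Fin m × Fin n) :
    IsSignedTwo t (Pi.single p (1 : ℝ)) := by
  have hnonneg : ∀ x, 0 ≤ (Pi.single p (1 : ℝ) : Fin m × Fin n → ℝ) x := fun x => by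
    rw [Pi.single_apply]; split_ifs <;> simp
  refine ⟨hnonneg, fun x y hxy => ?_⟩
  refine (le_of_eq ?_).trans (mul_nonneg (hnonneg _) (hnonneg _))
  by_cases hx : x = p
  · have hy : y ≠ p := by
      rintro rfl
      simp [hx, gridDisc] at hxy
    rw [Pi.single_eq_of_ne hy, mul_zero]
  · rw [Pi.single_eq_of_ne hx, zero_mul]

theorem isTwoRow_single (p : Fin m × Fin n) : IsTwoRow (Pi.single p (1 : ℝ)) :=
  ⟨p.1, p.1, fun _ hx _ => Pi.single_eq_of_ne (fun h => hx (congrArg Prod.fst h)) _⟩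

/-- A linear map that maps onto itself a set lying between the two-row SR₂(ε) matrices and all the
SR₂(ε) matrices is given by a monomial preserver. -/
theorem exists_isMonomialPreserver {ε : ℕ → ℝ} (h1 : ε 1 = 1 ∨ ε 1 = -1)
    (h2 : ε 2 = 1 ∨ ε 2 = -1) (𝓛 : Matrix (Fin m) (Fin n) ℝ →ₗ[ℝ] Matrix (Fin m) (Fin n) ℝ)
    (S : Set (Matrix (Fin m) (Fin n) ℝ)) (hsub : ∀ A ∈ S, IsSRkPat 2 ε A)
    (hmem : ∀ A, IsSRkPat 2 ε A → IsTwoRow (fun p => A p.1 p.2) → A ∈ S) (hS : 𝓛 '' S = S) :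
    ∃ T σ c, IsMonomialPreserver (m := m) (n := n) (ε 2) T σ c ∧
      ∀ A x, 𝓛 A (σ x).1 (σ x).2 = c x * A x.1 x.2 := by
  have hsq : ε 1 * ε 1 = 1 := by rcases h1 with h | h <;> rw [h] <;> norm_num
  let e : (Fin m × Fin n → ℝ) ≃ₗ[ℝ] Matrix (Fin m) (Fin n) ℝ :=
    LinearEquiv.curry ℝ ℝ (Fin m) (Fin n)
  have he : ∀ f i j, e f i j = f (i, j) := fun _ _ _ => rfl
  let L : (Fin m × Fin n → ℝ) →ₗ[ℝ] (Fin m × Fin n → ℝ) :=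
    e.symm.toLinearMap ∘ₗ 𝓛 ∘ₗ e.toLinearMap
  have heL : ∀ f, e (L f) = 𝓛 (e f) := fun f => e.apply_symm_apply _
  let T : Set (Fin m × Fin n → ℝ) := {f | ε 1 • e f ∈ S}
  have hTsub : ∀ f ∈ T, IsSignedTwo (ε 2) f := fun f hf => by
    have := (isSRkPat_two_iff h1 h2 _).1 (hsub _ hf)
    simpa only [Matrix.smul_apply, he, smul_eq_mul, ← mul_assoc, hsq, one_mul] using this
  have hTmem : ∀ f, IsSignedTwo (ε 2) f → IsTwoRow f → f ∈ T := fun f hf hrow => by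
    refine hmem _ ((isSRkPat_two_iff h1 h2 _).2 ?_) ?_
    · simpa only [Matrix.smul_apply, he, smul_eq_mul, ← mul_assoc, hsq, one_mul] using hf
    · obtain ⟨i, i', h⟩ := hrow
      exact ⟨i, i', fun x hx hx' => by simp [he, h x hx hx']⟩
  have hLT : L '' T = T := by
    refine Set.Subset.antisymm ?_ fun f hf => ?_
    · rintro _ ⟨f, hf, rfl⟩
      change ε 1 • e (L f) ∈ S
      rw [heL, ← map_smul, ← hS]
      exact Set.mem_image_of_mem _ hf
    · have hf' : ε 1 • e f ∈ 𝓛 '' S := by rw [hS]; exact hf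
      obtain ⟨A, hA, hAf⟩ := hf'
      refine ⟨e.symm (ε 1 • A), ?_, e.injective ?_⟩
      · change ε 1 • e (e.symm (ε 1 • A)) ∈ S
        rwa [e.apply_symm_apply, smul_smul, hsq, one_smul]
      · rw [heL, e.apply_symm_apply, map_smul, hAf, smul_smul, hsq, one_smul]
  obtain ⟨hinj, σ, c, hc, hσ⟩ := exists_monomial_of_image_eq L T hLT
    (fun f hf => (hTsub f hf).1) (fun p => hTmem _ (isSignedTwo_single _ p) (isTwoRow_single p))
  refine ⟨T, σ, c, ⟨hTsub, hTmem, hc, fun A B hAB => ?_⟩, fun A x => ?_⟩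
  · have hB : B = L A := by
      ext y
      obtain ⟨x, rfl⟩ := σ.surjective y
      rw [hAB, hσ]
    rw [hB]
    conv_rhs => rw [← hLT]
    exact (hinj.mem_set_image).symm
  · have := hσ (e.symm A) x
    rw [← e.apply_symm_apply A, ← heL]
    exact this

theorem exists_elemSRPatMap_list (hm : 2 ≤ m) (hn : 2 ≤ n) {ε : ℕ → ℝ}
    (h1 : ε 1 = 1 ∨ ε 1 = -1) (h2 : ε 2 = 1 ∨ ε 2 = -1)
    (𝓛 : Matrix (Fin m) (Fin n) ℝ →ₗ[ℝ] Matrix (Fin m) (Fin n) ℝ)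
    (S : Set (Matrix (Fin m) (Fin n) ℝ)) (hsub : ∀ A ∈ S, IsSRkPat 2 ε A)
    (hmem : ∀ A, IsSRkPat 2 ε A → IsTwoRow (fun p => A p.1 p.2) → A ∈ S) (hS : 𝓛 '' S = S) :
    ∃ L : List (Matrix (Fin m) (Fin n) ℝ → Matrix (Fin m) (Fin n) ℝ),
      L ≠ [] ∧ (∀ T ∈ L, ElemSRPatMap m n T) ∧ ⇑𝓛 = L.foldr (· ∘ ·) id := by
  obtain ⟨T, σ, c, h, h𝓛⟩ := exists_isMonomialPreserver h1 h2 𝓛 S hsub hmem hS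
  have ht : ε 2 ≠ 0 := by rcases h2 with h | h <;> rw [h] <;> norm_num
  obtain ⟨F, E, hF, hE, hc⟩ := h.exists_coeff_eq_mul ht ⟨0, by omega⟩ ⟨0, by omega⟩
  have hdiag : ElemSRPatMap m n fun A => Matrix.diagonal F * A * Matrix.diagonal E :=
    Or.inl ⟨F, E, hF, hE, rfl⟩
  have hexch : ElemSRPatMap m n fun A => exchangeMat m * A * exchangeMat n := Or.inr (Or.inl rfl)
  rcases h.perm_cases ht hm hn with hσ | hσ | ⟨rfl, hσ | hσ⟩
  · refine ⟨[_], by simp, by simpa using hdiag, ?_⟩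
    ext A i j
    have := h𝓛 A (i, j)
    simp only [hσ, hc] at this
    simp only [List.foldr, Function.comp_apply, id, Matrix.mul_diagonal, Matrix.diagonal_mul, this]
    ring
  · refine ⟨[_, _], by simp, by simpa using ⟨hexch, hdiag⟩, ?_⟩
    ext A i j
    have := h𝓛 A (i.rev, j.rev)
    simp only [hσ, hc, Fin.rev_rev] at this
    simp only [List.foldr, Function.comp_apply, id, exchangeMat_mul_mul_exchangeMat,
      Matrix.submatrix_apply, Matrix.mul_diagonal, Matrix.diagonal_mul, this]
    ring
  · refine ⟨[_, _], by simp, by simpa using ⟨Or.inr (Or.inr ⟨rfl, rfl⟩), hdiag⟩, ?_⟩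
    ext A i j
    have := h𝓛 A (j, i)
    simp only [hσ, hc, Fin.cast_eq_self] at this
    simp only [List.foldr, Function.comp_apply, id, Matrix.of_apply, Fin.cast_eq_self,
      Matrix.mul_diagonal, Matrix.diagonal_mul, this]
    ring
  · refine ⟨[_, _, _], by simp, by simpa using ⟨Or.inr (Or.inr ⟨rfl, rfl⟩), hexch, hdiag⟩, ?_⟩
    ext A i j
    have := h𝓛 A (j.rev, i.rev)
    simp only [hσ, hc, Fin.cast_eq_self, Fin.rev_rev] at this
    simp only [List.foldr, Function.comp_apply, id, Matrix.of_apply, Fin.cast_eq_self,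
      exchangeMat_mul_mul_exchangeMat, Matrix.submatrix_apply,
      Matrix.mul_diagonal, Matrix.diagonal_mul, this]
    ring

theorem IsSRkPat.of_isTwoRow {ε : ℕ → ℝ} {A : Matrix (Fin m) (Fin n) ℝ} (hA : IsSRkPat 2 ε A)
    (hrow : IsTwoRow fun p => A p.1 p.2) (k : ℕ) : IsSRkPat k ε A := by
  intro r hr1 hr2 f g hf hg hne
  by_cases hr : r ≤ 2
  · exact hA r hr1 hr f g hf hg hne
  obtain ⟨i, i', h⟩ := hrow
  obtain ⟨x, hx⟩ : ∃ x, f x ∉ ({i, i'} : Finset (Fin m)) := by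
    by_contra! hall
    have := Finset.card_le_card_of_injOn f (s := Finset.univ) (fun x _ => hall x)
      hf.injective.injOn
    rw [Finset.card_univ, Fintype.card_fin] at this
    exact hr (this.trans Finset.card_le_two)
  simp only [Finset.mem_insert, Finset.mem_singleton, not_or] at hx
  exact absurd (Matrix.det_eq_zero_of_row_eq_zero x fun y => h (f x, g y) hx.1 hx.2) hne

end Classification

/-- Theorem B: for `m, n ≥ 2` and a sign pattern
`ε ∈ {1,-1}^{min m n}`, a linear map `𝓛 : ℝ^{m×n} → ℝ^{m×n}` maps the SR(ε)
matrices onto themselves iff it maps the SR₂((ε₁,ε₂)) matrices onto themselves,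
iff it is a composition of one or more of the transformations (a)–(c). -/
theorem sr_pattern_linear_preserver (m n : ℕ) (hm : 2 ≤ m) (hn : 2 ≤ n)
    (ε : ℕ → ℝ) (hε : ∀ r : ℕ, 1 ≤ r → r ≤ min m n → ε r = 1 ∨ ε r = -1)
    (𝓛 : Matrix (Fin m) (Fin n) ℝ →ₗ[ℝ] Matrix (Fin m) (Fin n) ℝ) :
    ((⇑𝓛 '' {A | IsSRkPat (min m n) ε A} = {A | IsSRkPat (min m n) ε A}) ↔
      (⇑𝓛 '' {A | IsSRkPat 2 ε A} = {A | IsSRkPat 2 ε A})) ∧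
    ((⇑𝓛 '' {A | IsSRkPat 2 ε A} = {A | IsSRkPat 2 ε A}) ↔
      (∃ L : List (Matrix (Fin m) (Fin n) ℝ → Matrix (Fin m) (Fin n) ℝ),
        L ≠ [] ∧ (∀ T ∈ L, ElemSRPatMap m n T) ∧ ⇑𝓛 = L.foldr (· ∘ ·) id)) := by
  have hmin : 2 ≤ min m n := le_min hm hn
  have h1 := hε 1 le_rfl (one_le_two.trans hmin)
  have h2 := hε 2 one_le_two hmin
  have hlist := exists_elemSRPatMap_list hm hn h1 h2 𝓛
  have of_min := hlist {A | IsSRkPat (min m n) ε A}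
    (fun A hA r hr1 hr2 => hA r hr1 (hr2.trans hmin))
    (fun A hA hrow => hA.of_isTwoRow hrow _)
  have of_two := hlist {A | IsSRkPat 2 ε A} (fun A hA => hA) (fun A hA _ => hA)
  have of_list : (∃ L : List (Matrix (Fin m) (Fin n) ℝ → Matrix (Fin m) (Fin n) ℝ),
      L ≠ [] ∧ (∀ T ∈ L, ElemSRPatMap m n T) ∧ ⇑𝓛 = L.foldr (· ∘ ·) id) →
      ∀ k, ⇑𝓛 '' {A | IsSRkPat k ε A} = {A | IsSRkPat k ε A} := by
    rintro ⟨L, -, hL, h𝓛⟩ k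
    rw [h𝓛]
    exact image_foldr_comp_eq fun T hT => (hL T hT).image_eq k ε
  exact ⟨⟨fun h => of_list (of_min h) 2, fun h => of_list (of_two h) _⟩,
    ⟨of_two, fun h => of_list h 2⟩⟩
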